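/- Let (d_1, …, d_n) be a non-increasing sequence of positive integers with n ≥ 2 and d_1 ≤ n − 1, and set x := n − 1 − d_1. Then there exists a finite simple graph G with degree multiset {d_1, …, d_n} if and only if there exists a finite simple graph G' with degree multiset {d_2 − 1, …, d_n − 1} together with x copies of 1; moreover, for any such graphs G and G' the following equalities hold: |V(G)| + x = 1 + |V(G')|; 2·|E(G)| + 2x = d_1 + 2·|E(G')| + |V(G')|; sub(S_2, G) + x = C(d_1, 2) + sub(S_2, G') + 2·|E(G')|; and sub(S_j, G) = C(d_1, j) + sub(S_j, G') + sub(S_{j−1}, G') for every j ≥ 3. -/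

import Mathlib

/-- The star `S_j` with `j` leaves: vertex `0` is the centre, adjacent to the `j` leaves. -/
def starGraph (j : ℕ) : SimpleGraph (Fin (j + 1)) :=
  SimpleGraph.fromRel (fun a _ => a = 0)

/-- The number of subgraphs of `G` isomorphic to `F`. -/
noncomputable def subCount {α β : Type*} (F : SimpleGraph α) (G : SimpleGraph β) : ℕ :=
  Nat.card {H : G.Subgraph // Nonempty (F ≃g H.coe)}

/-- The multiset of vertex degrees of a finite simple graph. -/
noncomputable def degreeMultiset {V : Type*} [Fintype V] (G : SimpleGraph V) : Multiset ℕ :=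
  Finset.univ.val.map fun v => (G.neighborSet v).ncard

/-- Functions on finite types with the same multiset of values agree up to a bijection of their
domains. -/
theorem exists_equiv_of_map_univ_eq {α β γ : Type*} [Fintype α] [Fintype β] {f : α → γ}
    {g : β → γ} (h : Finset.univ.val.map f = Finset.univ.val.map g) :
    ∃ e : α ≃ β, ∀ a, g (e a) = f a := by
  classical
  have hcard : ∀ c, Fintype.card {a // f a = c} = Fintype.card {b // g b = c} := fun c => by
    have := congrArg (Multiset.count c) h
    simp only [Multiset.count_map] at this
    simpa [Fintype.card_subtype, Finset.card_def, Finset.filter_val, eq_comm] using this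
  exact ⟨Equiv.ofFiberEquiv fun c => Fintype.equivOfCardEq (hcard c),
    fun a => Equiv.ofFiberEquiv_map _ a⟩

theorem exists_realization_of_degreeMultiset_eq {V ι : Type*} [Fintype V] [Fintype ι]
    {G : SimpleGraph V} {f : ι → ℕ} (h : degreeMultiset G = Finset.univ.val.map f) :
    ∃ H : SimpleGraph ι, ∀ i, (H.neighborSet i).ncard = f i := by
  obtain ⟨e, he⟩ := exists_equiv_of_map_univ_eq h.symm
  refine ⟨G.comap e, fun i => ?_⟩
  rw [← he i, ← Set.ncard_image_of_injective _ e.injective]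
  congr 1
  ext v
  simp only [Set.mem_image, SimpleGraph.mem_neighborSet, SimpleGraph.comap_adj]
  exact ⟨by rintro ⟨x, hx, rfl⟩; exact hx, fun hv => ⟨e.symm v, by simpa using hv, by simp⟩⟩

/-- Replacing the edge `aw` by the edge `bw` moves one unit of degree from `a` to `b`. -/
theorem exists_move_edge {V : Type*} [Finite V] [DecidableEq V] (G : SimpleGraph V) {a b w : V}
    (haw : G.Adj a w) (hbw : ¬ G.Adj b w) (hne : b ≠ w) :
    ∃ H : SimpleGraph V, ∀ v, (H.neighborSet v).ncard + (if v = a then 1 else 0) =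
      (G.neighborSet v).ncard + (if v = b then 1 else 0) := by
  have hab : a ≠ b := fun h => hbw (h ▸ haw)
  have haw' : a ≠ w := haw.ne
  let H : SimpleGraph V :=
    { Adj := fun u v => (G.Adj u v ∧ ¬ (u = a ∧ v = w) ∧ ¬ (u = w ∧ v = a)) ∨
        (u = b ∧ v = w) ∨ (u = w ∧ v = b)
      symm := ⟨fun u v h => by have := G.adj_comm u v; tauto⟩
      loopless := ⟨fun u h => by
        rcases h with h | h | h
        · exact G.irrefl h.1
        · exact hne (h.1.symm.trans h.2)
        · exact hne (h.2.symm.trans h.1)⟩ }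
  have hH : ∀ u v, H.Adj u v ↔ (G.Adj u v ∧ ¬ (u = a ∧ v = w) ∧ ¬ (u = w ∧ v = a)) ∨
        (u = b ∧ v = w) ∨ (u = w ∧ v = b) := fun _ _ => Iff.rfl
  refine ⟨H, fun v => ?_⟩
  by_cases hvw : v = w
  · subst hvw
    have : H.neighborSet v = insert b (G.neighborSet v \ {a}) := by
      ext u
      simp only [SimpleGraph.mem_neighborSet, hH, Set.mem_insert_iff, Set.mem_sdiff,
        Set.mem_singleton_iff]
      grind
    have hav : a ∈ G.neighborSet v := haw.symm
    rw [this, Set.ncard_insert_of_notMem fun h => hbw h.1.symm,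
      Set.ncard_sdiff_singleton_add_one hav]
    simp [haw'.symm, hne.symm]
  by_cases hva : v = a
  · subst hva
    have : H.neighborSet v = G.neighborSet v \ {w} := by
      ext u
      simp only [SimpleGraph.mem_neighborSet, hH, Set.mem_sdiff, Set.mem_singleton_iff]
      grind
    have hw : w ∈ G.neighborSet v := haw
    rw [this, if_pos rfl, if_neg hab, Set.ncard_sdiff_singleton_add_one hw, add_zero]
  by_cases hvb : v = b
  · subst hvb
    have : H.neighborSet v = insert w (G.neighborSet v) := by
      ext u
      simp only [SimpleGraph.mem_neighborSet, hH, Set.mem_insert_iff]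
      grind
    have hw : w ∉ G.neighborSet v := hbw
    rw [this, if_pos rfl, if_neg hva, Set.ncard_insert_of_notMem hw, add_zero]
  · have : H.neighborSet v = G.neighborSet v := by
      ext u
      simp only [SimpleGraph.mem_neighborSet, hH]
      grind
    rw [this, if_neg hva, if_neg hvb]

theorem exists_attach_leaves {A L : Type*} [Finite A] [Finite L] {f : A → ℕ} {σ : L → A}
    (hσ : Function.Injective σ) (hpos : ∀ l, 0 < f (σ l)) {G : SimpleGraph (A ⊕ L)}
    (hA : ∀ a, (G.neighborSet (Sum.inl a)).ncard = f a)
    (hL : ∀ l, (G.neighborSet (Sum.inr l)).ncard = 0) [DecidableEq A] [DecidableEq L]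
    (T : Finset L) :
    ∃ H : SimpleGraph (A ⊕ L),
      (∀ a, (H.neighborSet (Sum.inl a)).ncard + (if a ∈ T.image σ then 1 else 0) = f a) ∧
      ∀ l, (H.neighborSet (Sum.inr l)).ncard = if l ∈ T then 1 else 0 := by
  induction T using Finset.induction_on with
  | empty => exact ⟨G, by simpa using hA, by simpa using hL⟩
  | insert t T ht ih =>
    obtain ⟨H, hHA, hHL⟩ := ih
    have hmem : σ t ∉ T.image σ := by
      simp only [Finset.mem_image, not_exists, not_and]
      exact fun l hl h => ht (hσ h ▸ hl)
    have hdeg : (H.neighborSet (Sum.inl (σ t))).ncard ≠ 0 := by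
      have := hHA (σ t)
      rw [if_neg hmem] at this
      have := hpos t
      omega
    obtain ⟨w, hw⟩ := Set.nonempty_of_ncard_ne_zero hdeg
    have hiso : H.neighborSet (Sum.inr t) = ∅ := by
      have := hHL t
      rwa [if_neg ht, Set.ncard_eq_zero] at this
    have htw : ∀ u, ¬ H.Adj (Sum.inr t) u := fun u hu => by
      have : u ∈ H.neighborSet (Sum.inr t) := hu
      simp [hiso] at this
    have hw' : H.Adj (Sum.inl (σ t)) w := hw
    obtain ⟨K, hK⟩ := exists_move_edge H hw' (htw w) (fun h => htw _ (h ▸ hw'.symm))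
    refine ⟨K, fun a => ?_, fun l => ?_⟩
    · have h1 := hK (Sum.inl a)
      have h2 := hHA a
      grind
    · have h1 := hK (Sum.inr l)
      have h2 := hHL l
      grind

theorem exists_mergeable_vertex {A L : Type*} [Fintype A] [Finite L] [DecidableEq A]
    {H : SimpleGraph (A ⊕ L)} {S : Finset A} {D : ℕ}
    (hA : ∀ a, (H.neighborSet (Sum.inl a)).ncard + 1 ≤ D + if a ∈ S then 1 else 0)
    (hL : ∀ l, (H.neighborSet (Sum.inr l)).ncard ≤ 1) (hcard : S.card + D < Fintype.card A)
    {t : L} {w : A ⊕ L} (hw : H.Adj (Sum.inr t) w) :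
    ∃ b ∉ S, ¬ H.Adj (Sum.inl b) w ∧ Sum.inl b ≠ w := by
  classical
  have hN : (Finset.univ.filter fun a => H.Adj w (Sum.inl a)).card + 1 ≤
      (H.neighborSet w).ncard := by
    rw [← Set.ncard_coe_finset, ← Set.ncard_image_of_injective _ (Sum.inl_injective (β := L)),
      ← Set.ncard_insert_of_notMem (a := Sum.inr t) (by simp)]
    refine Set.ncard_le_ncard ?_
    rintro x (rfl | ⟨a, ha, rfl⟩)
    · exact hw.symm
    · simpa using ha
  have hbad : ∃ b, b ∉ S ∪ (Finset.univ.filter fun a => H.Adj w (Sum.inl a)) ∪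
      (Finset.univ.filter fun a => Sum.inl a = w) := by
    by_contra! hall
    have huniv := Finset.card_le_card (fun b _ => hall b : Finset.univ ⊆ _)
    rw [Finset.card_univ] at huniv
    cases w with
    | inl c =>
      have hc : (Finset.univ.filter fun a : A => (Sum.inl a : A ⊕ L) = Sum.inl c) = {c} := by
        ext; simp
      rw [hc] at huniv
      have h1 := hA c
      by_cases hcS : c ∈ S
      · rw [Finset.union_eq_left.2 (by simp [hcS])] at huniv
        have := Finset.card_union_le S (Finset.univ.filter fun a => H.Adj (Sum.inl c) (Sum.inl a))
        rw [if_pos hcS] at h1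
        omega
      · have := Finset.card_union_le S (Finset.univ.filter fun a => H.Adj (Sum.inl c) (Sum.inl a))
        have := Finset.card_union_le
          (S ∪ Finset.univ.filter fun a => H.Adj (Sum.inl c) (Sum.inl a)) {c}
        rw [Finset.card_singleton] at this
        rw [if_neg hcS] at h1
        omega
    | inr l =>
      have h1 := hL l
      have h2 : (Finset.univ.filter fun a => H.Adj (Sum.inr l) (Sum.inl a)) = ∅ := by
        rw [← Finset.card_eq_zero]; omega
      simp [h2] at huniv
      omega
  obtain ⟨b, hb⟩ := hbad
  simp only [Finset.mem_union, Finset.mem_filter, Finset.mem_univ, true_and, not_or] at hb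
  exact ⟨b, hb.1.1, fun h => hb.1.2 h.symm, hb.2⟩

theorem exists_merge_leaves {A L : Type*} [Fintype A] [Fintype L] [DecidableEq A] [DecidableEq L]
    {f : A → ℕ} {D : ℕ} (hf : ∀ a, f a + 1 ≤ D)
    (hcard : Fintype.card A = D + Fintype.card L) {G : SimpleGraph (A ⊕ L)}
    (hA : ∀ a, (G.neighborSet (Sum.inl a)).ncard = f a)
    (hL : ∀ l, (G.neighborSet (Sum.inr l)).ncard = 1) (T : Finset L) :
    ∃ (H : SimpleGraph (A ⊕ L)) (S : Finset A), S.card = T.card ∧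
      (∀ a, (H.neighborSet (Sum.inl a)).ncard = f a + if a ∈ S then 1 else 0) ∧
      ∀ l, (H.neighborSet (Sum.inr l)).ncard = if l ∈ T then 0 else 1 := by
  induction T using Finset.induction_on with
  | empty => exact ⟨G, ∅, rfl, by simpa using hA, by simpa using hL⟩
  | insert t T ht ih =>
    obtain ⟨H, S, hST, hHA, hHL⟩ := ih
    have hTL : T.card < Fintype.card L :=
      Finset.card_lt_univ_of_notMem ht
    have hdeg : (H.neighborSet (Sum.inr t)).ncard ≠ 0 := by
      rw [hHL, if_neg ht]; exact one_ne_zero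
    obtain ⟨w, hw⟩ := Set.nonempty_of_ncard_ne_zero hdeg
    have hw' : H.Adj (Sum.inr t) w := hw
    obtain ⟨b, hbS, hbw, hne⟩ := exists_mergeable_vertex (S := S) (D := D)
      (fun a => by have := hf a; rw [hHA a]; omega)
      (fun l => by rw [hHL l]; split_ifs <;> omega) (by omega) hw'
    obtain ⟨K, hK⟩ := exists_move_edge H hw' hbw hne
    refine ⟨K, insert b S, ?_, fun a => ?_, fun l => ?_⟩
    · rw [Finset.card_insert_of_notMem hbS, Finset.card_insert_of_notMem ht, hST]
    · have h1 := hK (Sum.inl a)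
      have h2 := hHA a
      grind
    · have h1 := hK (Sum.inr l)
      have h2 := hHL l
      grind

/-- Adding a new vertex adjacent to exactly the vertices of `N`. -/
def addVertex {A : Type*} (G : SimpleGraph A) (N : Set A) : SimpleGraph (Option A) where
  Adj
    | none, none => False
    | none, some a => a ∈ N
    | some a, none => a ∈ N
    | some a, some b => G.Adj a b
  symm := ⟨by
    rintro (_ | a) (_ | b) h
    exacts [h, h, h, G.symm.symm _ _ h]⟩
  loopless := ⟨by
    rintro (_ | a) h
    exacts [h, G.irrefl h]⟩

theorem ncard_neighborSet_addVertex_none {A : Type*} (G : SimpleGraph A) (N : Set A) :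
    ((addVertex G N).neighborSet none).ncard = N.ncard := by
  rw [← Set.ncard_image_of_injective N (Option.some_injective A)]
  congr 1
  ext (_ | a) <;> simp [addVertex]

open Classical in
theorem ncard_neighborSet_addVertex_some {A : Type*} [Finite A] (G : SimpleGraph A) (N : Set A)
    (a : A) : ((addVertex G N).neighborSet (some a)).ncard =
      (G.neighborSet a).ncard + if a ∈ N then 1 else 0 := by
  rw [← Set.ncard_image_of_injective (G.neighborSet a) (Option.some_injective A)]
  split_ifs with h
  · rw [← Set.ncard_insert_of_notMem (a := none) (by simp)]
    congr 1
    ext (_ | b) <;> simp [addVertex, h]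
  · congr 1
    ext (_ | b) <;> simp [addVertex, h]

theorem eq_addVertex {A : Type*} (G : SimpleGraph (Option A)) :
    G = addVertex (G.comap some) {a | G.Adj none (some a)} := by
  ext (_ | a) (_ | b) <;> simp [addVertex, G.adj_comm]

theorem ncard_neighborSet_sum_inl {A L : Type*} {G : SimpleGraph (A ⊕ L)}
    (hG : ∀ a l, ¬ G.Adj (Sum.inl a) (Sum.inr l)) (a : A) :
    (G.neighborSet (Sum.inl a)).ncard = ((G.comap Sum.inl).neighborSet a).ncard := by
  have : G.neighborSet (Sum.inl a) = Sum.inl '' (G.comap Sum.inl).neighborSet a := by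
    ext (b | l) <;> simp [hG]
  rw [this, Set.ncard_image_of_injective _ Sum.inl_injective]

/-- A graph realizing degree `D` at a vertex and `g` elsewhere exists iff a graph realizing `g - 1`
together with one leaf for every non-neighbour of that vertex exists. -/
theorem exists_realization_iff {A L : Type*} [Fintype A] [Fintype L] {g : A → ℕ} {D : ℕ}
    (hg : ∀ a, 0 < g a) (hgD : ∀ a, g a ≤ D) (hcard : Fintype.card A = D + Fintype.card L) :
    (∃ G : SimpleGraph (Option A), (G.neighborSet none).ncard = D ∧
      ∀ a, (G.neighborSet (some a)).ncard = g a) ↔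
    ∃ G : SimpleGraph (A ⊕ L), (∀ a, (G.neighborSet (Sum.inl a)).ncard = g a - 1) ∧
      ∀ l, (G.neighborSet (Sum.inr l)).ncard = 1 := by
  classical
  constructor
  · rintro ⟨G, hD, hG⟩
    obtain ⟨G₀, N, rfl⟩ : ∃ G₀ N, G = addVertex G₀ N := ⟨_, _, eq_addVertex G⟩
    rw [ncard_neighborSet_addVertex_none] at hD
    simp_rw [ncard_neighborSet_addVertex_some] at hG
    have hcompl : Fintype.card L = Fintype.card {a // a ∉ N} := by
      have := Set.ncard_add_ncard_compl N
      rw [Nat.card_eq_fintype_card, Set.ncard_eq_toFinset_card' Nᶜ, Set.toFinset_card] at this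
      have h2 : Fintype.card {a // a ∉ N} = Fintype.card ↑Nᶜ := Fintype.card_congr (Equiv.refl _)
      omega
    obtain e := Fintype.equivOfCardEq hcompl
    have hG' : ∀ a, ((G₀ ⊕g (⊥ : SimpleGraph L)).neighborSet (Sum.inl a)).ncard =
        (G₀.neighborSet a).ncard := fun a => by
      rw [ncard_neighborSet_sum_inl (by simp)]
      congr 1
    obtain ⟨H, hHA, hHL⟩ := exists_attach_leaves (f := fun a => (G₀.neighborSet a).ncard)
      (σ := fun l => (e l : A)) (Subtype.val_injective.comp e.injective)
      (fun l => by
        have h1 := hG (e l)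
        rw [if_neg (e l).2] at h1
        have := hg (e l)
        omega) hG'
      (fun l => by
        rw [Set.ncard_eq_zero]
        ext (b | b) <;> simp) Finset.univ
    refine ⟨H, fun a => ?_, by simpa using hHL⟩
    have h1 := hHA a
    have h2 := hG a
    have h3 : a ∈ Finset.univ.image (fun l => (e l : A)) ↔ a ∉ N := by
      simp only [Finset.mem_image, Finset.mem_univ, true_and]
      exact ⟨by rintro ⟨l, rfl⟩; exact (e l).2, fun h => ⟨e.symm ⟨a, h⟩, by simp⟩⟩
    simp only [h3] at h1
    by_cases ha : a ∈ N <;> simp [ha] at h1 h2 <;> omega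
  · rintro ⟨G, hGA, hGL⟩
    obtain ⟨H, S, hS, hHA, hHL⟩ := exists_merge_leaves (f := fun a => g a - 1) (D := D)
      (fun a => by have := hg a; have := hgD a; omega) hcard hGA hGL Finset.univ
    have hiso : ∀ a l, ¬ H.Adj (Sum.inl a) (Sum.inr l) := fun a l h => by
      have h1 := hHL l
      rw [if_pos (Finset.mem_univ l), Set.ncard_eq_zero] at h1
      have h2 : Sum.inl a ∈ H.neighborSet (Sum.inr l) := h.symm
      simp [h1] at h2
    refine ⟨addVertex (H.comap Sum.inl) (↑S)ᶜ, ?_, fun a => ?_⟩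
    · rw [ncard_neighborSet_addVertex_none]
      have := Set.ncard_add_ncard_compl (S : Set A)
      rw [Nat.card_eq_fintype_card, Set.ncard_coe_finset, hS, Finset.card_univ] at this
      omega
    · rw [ncard_neighborSet_addVertex_some, ← ncard_neighborSet_sum_inl hiso, hHA]
      have := hg a
      by_cases ha : a ∈ S <;> simp [ha] <;> omega

theorem starGraph_adj {j : ℕ} {a b : Fin (j + 1)} :
    (starGraph j).Adj a b ↔ a ≠ b ∧ (a = 0 ∨ b = 0) :=
  SimpleGraph.fromRel_adj _ _ _

/-- The star with centre `v` and leaves `s`, as a subgraph of `G`. -/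
def starSubgraph {V : Type*} (G : SimpleGraph V) (v : V) (s : Set V)
    (hs : s ⊆ G.neighborSet v) : G.Subgraph where
  verts := insert v s
  Adj a b := (a = v ∧ b ∈ s) ∨ (b = v ∧ a ∈ s)
  adj_sub := by
    rintro a b (⟨rfl, h⟩ | ⟨rfl, h⟩)
    exacts [hs h, (hs h).symm]
  edge_vert := by
    rintro a b (⟨rfl, -⟩ | ⟨-, h⟩)
    exacts [Set.mem_insert _ _, Set.mem_insert_of_mem _ h]
  symm := ⟨fun _ _ h => h.symm⟩

theorem nonempty_iso_starSubgraph {V : Type*} {G : SimpleGraph V} {v : V} {s : Finset V}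
    (hs : (s : Set V) ⊆ G.neighborSet v) :
    Nonempty (starGraph s.card ≃g (starSubgraph G v s hs).coe) := by
  have hv : v ∉ s := fun h => G.irrefl (hs h)
  let e := s.equivFin.symm
  let f : Fin (s.card + 1) → V := Fin.cons v fun i => (e i : V)
  have hf : Function.Injective f :=
    Fin.cons_injective_iff.2 ⟨by rintro ⟨i, hi⟩; exact hv (hi ▸ (e i).2),
      Subtype.val_injective.comp e.injective⟩
  have hrange : Set.range f = (starSubgraph G v s hs).verts := by
    have : Set.range (fun i => (e i : V)) = s := by
      ext x
      exact ⟨by rintro ⟨i, rfl⟩; exact (e i).2, fun hx => ⟨e.symm ⟨x, hx⟩, by simp⟩⟩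
    simp only [f, Fin.range_cons, this]
    rfl
  refine ⟨(Equiv.ofInjective f hf).trans (Equiv.setCongr hrange), ?_⟩
  intro a b
  change ((f a = v ∧ f b ∈ (s : Set V)) ∨ (f b = v ∧ f a ∈ (s : Set V))) ↔ _
  have h0 : ∀ c, f c = v ↔ c = 0 := fun c => ⟨fun h => hf h, by rintro rfl; rfl⟩
  have h1 : ∀ c, f c ∈ (s : Set V) ↔ c ≠ 0 := fun c => by
    refine ⟨?_, fun h => ?_⟩
    · rintro h rfl
      exact hv h
    · obtain ⟨i, rfl⟩ := Fin.exists_succ_eq.2 h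
      simp [f]
  rw [h0, h0, h1, h1, starGraph_adj]
  grind

theorem exists_eq_starSubgraph {V : Type*} {G : SimpleGraph V} {j : ℕ} {H : G.Subgraph}
    (e : starGraph j ≃g H.coe) :
    ∃ (v : V) (s : Finset V) (hs : (s : Set V) ⊆ G.neighborSet v),
      s.card = j ∧ H = starSubgraph G v s hs := by
  have hadj : ∀ a b, H.Adj (e a) (e b) ↔ (starGraph j).Adj a b := fun a b => e.map_rel_iff
  let g : Fin j ↪ V :=
    ⟨fun i => (e i.succ : V), fun a b h => Fin.succ_injective _ (e.injective (Subtype.ext h))⟩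
  have hg : ∀ x, x ∈ Finset.univ.map g ↔ ∃ i : Fin j, (e i.succ : V) = x := fun x => by
    simp only [Finset.mem_map, Finset.mem_univ, true_and]
    rfl
  have hs : ((Finset.univ.map g : Finset V) : Set V) ⊆ G.neighborSet (e 0) := by
    intro x hx
    obtain ⟨i, rfl⟩ := (hg x).1 hx
    exact ((hadj _ _).2 (starGraph_adj.2 ⟨(Fin.succ_ne_zero i).symm, Or.inl rfl⟩)).adj_sub
  refine ⟨e 0, Finset.univ.map g, hs, by simp, ?_⟩
  have hmem : ∀ a : Fin (j + 1), (e a : V) ∈ Finset.univ.map g ↔ a ≠ 0 := fun a => by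
    rw [hg]
    refine ⟨?_, fun h => ?_⟩
    · rintro ⟨i, hi⟩ rfl
      exact Fin.succ_ne_zero i (e.injective (Subtype.ext hi))
    · obtain ⟨i, rfl⟩ := Fin.exists_succ_eq.2 h
      exact ⟨i, rfl⟩
  have hzero : ∀ a : Fin (j + 1), (e a : V) = e 0 ↔ a = 0 := fun a =>
    ⟨fun h => e.injective (Subtype.ext h), by rintro rfl; rfl⟩
  have hverts : H.verts = (starSubgraph G (e 0) _ hs).verts := by
    ext x
    constructor
    · intro hx
      obtain ⟨a, ha⟩ := e.surjective ⟨x, hx⟩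
      obtain rfl : (e a : V) = x := congrArg Subtype.val ha
      by_cases h : a = 0
      · exact Or.inl ((hzero a).2 h)
      · exact Or.inr ((hmem a).2 h)
    · rintro (rfl | hx)
      · exact (e 0).2
      · obtain ⟨i, rfl⟩ := (hg x).1 hx
        exact (e i.succ).2
  refine SimpleGraph.Subgraph.ext hverts ?_
  ext x y
  have key : ∀ a b : Fin (j + 1), H.Adj (e a) (e b) ↔
      (starSubgraph G (e 0) _ hs).Adj (e a) (e b) := fun a b => by
    change _ ↔ (((e a : V) = e 0 ∧ (e b : V) ∈ Finset.univ.map g) ∨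
      ((e b : V) = e 0 ∧ (e a : V) ∈ Finset.univ.map g))
    rw [hadj, hzero, hzero, hmem, hmem, starGraph_adj]
    grind
  have lift : ∀ x ∈ H.verts, ∃ a, (e a : V) = x := fun x hx => by
    obtain ⟨a, ha⟩ := e.surjective ⟨x, hx⟩
    exact ⟨a, congrArg Subtype.val ha⟩
  constructor <;> intro h
  · obtain ⟨a, rfl⟩ := lift x h.fst_mem
    obtain ⟨b, rfl⟩ := lift y h.snd_mem
    exact (key a b).1 h
  · obtain ⟨a, rfl⟩ := lift x (hverts ▸ h.fst_mem)
    obtain ⟨b, rfl⟩ := lift y (hverts ▸ h.snd_mem)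
    exact (key a b).2 h

theorem starSubgraph_injective {V : Type*} {G : SimpleGraph V} {v v' : V} {s s' : Finset V}
    (hs : (s : Set V) ⊆ G.neighborSet v) (hs' : (s' : Set V) ⊆ G.neighborSet v')
    (hcard : 2 ≤ s.card) (h : starSubgraph G v s hs = starSubgraph G v' s' hs') :
    v = v' ∧ s = s' := by
  have hadj : ∀ a b, ((a = v ∧ b ∈ s) ∨ (b = v ∧ a ∈ s)) ↔
      ((a = v' ∧ b ∈ s') ∨ (b = v' ∧ a ∈ s')) := fun a b =>
    iff_of_eq (congrFun (congrFun (congrArg SimpleGraph.Subgraph.Adj h) a) b)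
  have hv : v ∉ s := fun h => G.irrefl (hs h)
  have hv' : v' ∉ s' := fun h => G.irrefl (hs' h)
  obtain rfl : v = v' := by
    by_contra hne
    obtain ⟨u, hu, huv⟩ := Finset.exists_mem_ne hcard v'
    rcases (hadj v u).1 (Or.inl ⟨rfl, hu⟩) with h | h
    exacts [hne h.1, huv h.1]
  refine ⟨rfl, ?_⟩
  ext u
  have := hadj v u
  grind

theorem subCount_starGraph {V : Type*} [Fintype V] (G : SimpleGraph V) {j : ℕ} (hj : 2 ≤ j) :
    subCount (starGraph j) G = ∑ v, ((G.neighborSet v).ncard).choose j := by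
  classical
  have hsub : ∀ {v : V} {s : Finset V}, s ∈ (G.neighborFinset v).powersetCard j →
      (s : Set V) ⊆ G.neighborSet v := fun {v s} h => by
    rw [← SimpleGraph.coe_neighborFinset]
    exact Finset.coe_subset.2 (Finset.mem_powersetCard.1 h).1
  let φ : (Σ v : V, {s : Finset V // s ∈ (G.neighborFinset v).powersetCard j}) →
      {H : G.Subgraph // Nonempty (starGraph j ≃g H.coe)} := fun p =>
    ⟨starSubgraph G p.1 p.2.1 (hsub p.2.2), by
      have := nonempty_iso_starSubgraph (hsub p.2.2)
      rwa [(Finset.mem_powersetCard.1 p.2.2).2] at this⟩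
  have hφ : Function.Bijective φ := by
    constructor
    · rintro ⟨v, s, hs⟩ ⟨v', s', hs'⟩ h
      obtain ⟨rfl, rfl⟩ := starSubgraph_injective (hsub hs) (hsub hs')
        (hj.trans_eq (Finset.mem_powersetCard.1 hs).2.symm) (congrArg Subtype.val h)
      rfl
    · rintro ⟨H, ⟨e⟩⟩
      obtain ⟨v, s, hs, hcard, rfl⟩ := exists_eq_starSubgraph e
      refine ⟨⟨v, s, Finset.mem_powersetCard.2 ⟨fun x hx => ?_, hcard⟩⟩, rfl⟩
      exact (SimpleGraph.mem_neighborFinset _ _ _).2 (hs hx)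
  rw [subCount, ← Nat.card_congr (Equiv.ofBijective φ hφ), Nat.card_sigma]
  refine Finset.sum_congr rfl fun v _ => ?_
  rw [Nat.card_eq_fintype_card, Fintype.card_coe, Finset.card_powersetCard,
    ← Set.ncard_coe_finset, SimpleGraph.coe_neighborFinset]

theorem sum_ncard_neighborSet {V : Type*} [Fintype V] (G : SimpleGraph V) :
    ∑ v, (G.neighborSet v).ncard = 2 * G.edgeSet.ncard := by
  classical
  rw [← SimpleGraph.coe_edgeFinset, Set.ncard_coe_finset,
    ← SimpleGraph.sum_degrees_eq_twice_card_edges]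
  refine Finset.sum_congr rfl fun v _ => ?_
  rw [← SimpleGraph.card_neighborFinset_eq_degree, ← Set.ncard_coe_finset,
    SimpleGraph.coe_neighborFinset]

theorem sum_map_degreeMultiset {V : Type*} [Fintype V] (G : SimpleGraph V) (h : ℕ → ℕ) :
    ((degreeMultiset G).map h).sum = ∑ v, h (G.neighborSet v).ncard := by
  rw [degreeMultiset, Multiset.map_map]
  rfl

/-- with `x := n - 1 - d 1`, a graph `G` with degree multiset
`{d 1, …, d n}` exists iff a graph `G'` with degree multiset `{d 2 - 1, …, d n - 1}`
together with `x` copies of `1` exists; moreover, for any such graphs `G, G'` the stated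
count equalities hold. -/
theorem stmt7 (n : ℕ) (d : ℕ → ℕ) (hn : 2 ≤ n)
    (hpos : ∀ i ∈ Finset.Icc 1 n, 0 < d i)
    (hmono : ∀ i j, 1 ≤ i → i ≤ j → j ≤ n → d j ≤ d i)
    (hd1 : d 1 ≤ n - 1) :
    ((∃ (V : Type) (_ : Fintype V) (G : SimpleGraph V),
        degreeMultiset G = (Finset.Icc 1 n).val.map d) ↔
      (∃ (V' : Type) (_ : Fintype V') (G' : SimpleGraph V'),
        degreeMultiset G' = (Finset.Icc 2 n).val.map (fun i => d i - 1) +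
          Multiset.replicate (n - 1 - d 1) 1)) ∧
    (∀ (V V' : Type) [Fintype V] [Fintype V'] (G : SimpleGraph V) (G' : SimpleGraph V'),
      degreeMultiset G = (Finset.Icc 1 n).val.map d →
      degreeMultiset G' = (Finset.Icc 2 n).val.map (fun i => d i - 1) +
        Multiset.replicate (n - 1 - d 1) 1 →
      Fintype.card V + (n - 1 - d 1) = 1 + Fintype.card V' ∧
      2 * G.edgeSet.ncard + 2 * (n - 1 - d 1)
        = d 1 + 2 * G'.edgeSet.ncard + Fintype.card V' ∧
      subCount (starGraph 2) G + (n - 1 - d 1)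
        = (d 1).choose 2 + subCount (starGraph 2) G' + 2 * G'.edgeSet.ncard ∧
      ∀ j : ℕ, 3 ≤ j → subCount (starGraph j) G
        = (d 1).choose j + subCount (starGraph j) G' + subCount (starGraph (j - 1)) G') := by
  obtain ⟨m, rfl⟩ : ∃ m, n = m + 1 := ⟨n - 1, by omega⟩
  obtain ⟨x, hx⟩ : ∃ x, m + 1 - 1 - d 1 = x := ⟨_, rfl⟩
  rw [hx]
  have hIcc : Finset.Icc 1 (m + 1) = Finset.cons 1 (Finset.Icc 2 (m + 1)) (by simp) := by
    ext i
    simp only [Finset.mem_Icc, Finset.mem_cons]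
    omega
  have hpos2 : ∀ i ∈ Finset.Icc 2 (m + 1), 0 < d i := fun i hi =>
    hpos i (by rw [Finset.mem_Icc] at hi ⊢; omega)
  have hcons : (Finset.Icc 1 (m + 1)).val.map d = d 1 ::ₘ (Finset.Icc 2 (m + 1)).val.map d := by
    rw [hIcc, Finset.cons_val, Multiset.map_cons]
  have hattach : ∀ h : ℕ → ℕ, (Finset.Icc 2 (m + 1)).val.map h =
      (Finset.univ : Finset (Finset.Icc 2 (m + 1))).val.map (fun i : Finset.Icc 2 (m + 1) => h i) := fun h =>
    (Multiset.attach_map_val' _ _).symm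
  have hopt : (Finset.Icc 1 (m + 1)).val.map d =
      (Finset.univ : Finset (Option (Finset.Icc 2 (m + 1)))).val.map
        fun o => o.elim (d 1) fun i => d i := by
    have huniv : (Finset.univ : Finset (Option (Finset.Icc 2 (m + 1)))).val =
        none ::ₘ Finset.univ.val.map some := rfl
    rw [hcons, hattach, huniv, Multiset.map_cons, Multiset.map_map]
    rfl
  have hsum : (Finset.Icc 2 (m + 1)).val.map (fun i => d i - 1) + Multiset.replicate x 1 =
      (Finset.univ : Finset (Finset.Icc 2 (m + 1) ⊕ Fin x)).val.map
        (Sum.elim (fun i : Finset.Icc 2 (m + 1) => d i - 1) fun _ => 1) := by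
    rw [hattach, ← Finset.univ_disjSum_univ, Finset.val_disjSum, Multiset.map_disjSum]
    simp
  have hiff := exists_realization_iff (A := Finset.Icc 2 (m + 1)) (L := Fin x)
    (g := fun i => d i) (D := d 1) (fun i => hpos2 i i.2)
    (fun i => by
      have := Finset.mem_Icc.1 i.2
      exact hmono 1 i le_rfl (by omega) (by omega))
    (by simp only [Fintype.card_coe, Nat.card_Icc, Fintype.card_fin]; omega)
  refine ⟨⟨?_, ?_⟩, ?_⟩
  · rintro ⟨V, _, G, hG⟩
    obtain ⟨H, hH⟩ := exists_realization_of_degreeMultiset_eq (hG.trans hopt)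
    obtain ⟨K, hKA, hKL⟩ := hiff.1 ⟨H, hH none, fun a => hH (some a)⟩
    refine ⟨_, inferInstance, K, ?_⟩
    rw [hsum, degreeMultiset]
    congr 1
    ext (a | l)
    exacts [hKA a, hKL l]
  · rintro ⟨V, _, G, hG⟩
    obtain ⟨H, hH⟩ := exists_realization_of_degreeMultiset_eq (hG.trans hsum)
    obtain ⟨K, hKn, hKs⟩ := hiff.2 ⟨H, fun a => hH (Sum.inl a), fun l => hH (Sum.inr l)⟩
    refine ⟨_, inferInstance, K, ?_⟩
    rw [hopt, degreeMultiset]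
    congr 1
    ext (_ | a)
    exacts [hKn, hKs a]
  · intro V V' _ _ G G' hG hG'
    have hGsum : ∀ h : ℕ → ℕ, ∑ v, h (G.neighborSet v).ncard =
        h (d 1) + ∑ i ∈ Finset.Icc 2 (m + 1), h (d i) := fun h => by
      rw [← sum_map_degreeMultiset, hG, hcons, Multiset.map_cons, Multiset.sum_cons,
        Multiset.map_map]
      rfl
    have hG'sum : ∀ h : ℕ → ℕ, ∑ v, h (G'.neighborSet v).ncard =
        ∑ i ∈ Finset.Icc 2 (m + 1), h (d i - 1) + x * h 1 := fun h => by
      rw [← sum_map_degreeMultiset, hG', Multiset.map_add, Multiset.sum_add,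
        Multiset.map_map, Multiset.map_replicate, Multiset.sum_replicate, smul_eq_mul]
      rfl
    have hV : Fintype.card V = 1 + m := by
      simpa using hGsum fun _ => 1
    have hV' : Fintype.card V' = m + x := by
      simpa using hG'sum fun _ => 1
    have hE := (sum_ncard_neighborSet G).symm.trans (hGsum id)
    have hE' := (sum_ncard_neighborSet G').symm.trans (hG'sum id)
    have hdsum : ∑ i ∈ Finset.Icc 2 (m + 1), id (d i) =
        ∑ i ∈ Finset.Icc 2 (m + 1), id (d i - 1) + m := by
      have hsucc : ∀ i ∈ Finset.Icc 2 (m + 1), id (d i) = id (d i - 1) + 1 := fun i hi =>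
        (Nat.sub_add_cancel (hpos2 i hi)).symm
      rw [Finset.sum_congr rfl hsucc, Finset.sum_add_distrib]
      simp
    have hpascal : ∀ k, ∑ i ∈ Finset.Icc 2 (m + 1), (d i).choose (k + 1) =
        ∑ i ∈ Finset.Icc 2 (m + 1), (d i - 1).choose (k + 1) +
          ∑ i ∈ Finset.Icc 2 (m + 1), (d i - 1).choose k := fun k => by
      rw [← Finset.sum_add_distrib]
      refine Finset.sum_congr rfl fun i hi => ?_
      obtain ⟨c, hc⟩ := Nat.exists_eq_succ_of_ne_zero (hpos2 i hi).ne'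
      rw [hc, Nat.choose_succ_succ, add_comm]
      rfl
    simp only [id] at hE hE' hdsum
    refine ⟨by omega, by omega, ?_, fun j hj => ?_⟩
    · rw [subCount_starGraph _ le_rfl, subCount_starGraph _ le_rfl, hGsum (·.choose 2),
        hG'sum (·.choose 2), hpascal 1]
      simp only [Nat.reduceAdd, Nat.choose_one_right, Nat.choose_eq_zero_of_lt one_lt_two]
      omega
    · obtain ⟨k, rfl⟩ : ∃ k, j = k + 1 := ⟨j - 1, by omega⟩
      rw [Nat.add_sub_cancel, subCount_starGraph _ (by omega), subCount_starGraph _ (by omega),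
        subCount_starGraph _ (by omega), hGsum (·.choose (k + 1)), hG'sum (·.choose (k + 1)),
        hG'sum (·.choose k), hpascal k, Nat.choose_eq_zero_of_lt (by omega : 1 < k),
        Nat.choose_eq_zero_of_lt (by omega : 1 < k + 1)]
      omega
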